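/- Let E = (E⁰, E¹, d, r) be a topological graph and E₁ = (E₁⁰, E₁¹, d₁, r₁) its dual topological graph. Define m₁⁰ : E₁⁰ → E⁰ by m₁⁰(v,e) = v and m₁¹ : E₁¹ → E¹ by m₁¹(e',e) = e'. Then m₁ = (m₁⁰, m₁¹) is a regular surjective factor map from E₁ to E; that is: m₁⁰ and m₁¹ are proper continuous surjections, d ∘ m₁¹ = m₁⁰ ∘ d₁ and r ∘ m₁¹ = m₁⁰ ∘ r₁, for every e' ∈ E¹ and w ∈ E₁⁰ with d(e') = m₁⁰(w) there is a unique f ∈ E₁¹ with m₁¹(f) = e' and d₁(f) = w, and (m₁⁰)⁻¹(E⁰_rg) ⊆ (E₁⁰)_rg. -/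

import Mathlib

open OnePoint Set Topology

universe u w

variable {V : Type u} {E : Type w} [TopologicalSpace V] [TopologicalSpace E]

/-- `E⁰_fin`: vertices having an open neighborhood whose `r`-preimage is compact. -/
def grFin (r : E → V) : Set V :=
  {v | ∃ U : Set V, IsOpen U ∧ v ∈ U ∧ IsCompact (r ⁻¹' U)}

/-- `E⁰_sce`: the complement of the closure of the range of `r`. -/
def grSce (r : E → V) : Set V := (closure (Set.range r))ᶜ

/-- `E⁰_rg`: the set of regular vertices. -/
def grRg (r : E → V) : Set V := grFin r \ closure (grSce r)

/-- `E⁰_sg`: the set of singular vertices. -/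
def grSg (r : E → V) : Set V := (grRg r)ᶜ

/-- `E¹_rg := d⁻¹(E⁰_rg)`. -/
def grERg (d r : E → V) : Set E := d ⁻¹' grRg r

/-- The vertex space `E₁⁰` of the dual graph. -/
def dual0 (r : E → V) : Set (V × OnePoint E) :=
  {p | (∀ e : E, p.2 = (e : OnePoint E) → p.1 = r e) ∧ (p.2 = ∞ → p.1 ∈ grSg r)}

/-- The edge space `E₁¹` of the dual graph. -/
def dual1 (d r : E → V) : Set (E × OnePoint E) :=
  {p | (∀ e : E, p.2 = (e : OnePoint E) → d p.1 = r e) ∧ (p.2 = ∞ → p.1 ∉ grERg d r)}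

/-- `Ẽ₁⁰ = E₁⁰ ∪ {(∞,∞)}` inside `Ẽ⁰ × Ẽ¹`. -/
def tdual0 (r : E → V) : Set (OnePoint V × OnePoint E) :=
  (fun p : V × OnePoint E => ((p.1 : OnePoint V), p.2)) '' dual0 r ∪ {((∞ : OnePoint V), (∞ : OnePoint E))}

/-- `Ẽ₁¹ = E₁¹ ∪ {(∞,∞)}` inside `Ẽ¹ × Ẽ¹`. -/
def tdual1 (d r : E → V) : Set (OnePoint E × OnePoint E) :=
  (fun p : E × OnePoint E => ((p.1 : OnePoint E), p.2)) '' dual1 d r ∪ {((∞ : OnePoint E), (∞ : OnePoint E))}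

/-- The domain map `d₁ : E₁¹ → E₁⁰`, `d₁(e',e) = (d(e'), e)`. -/
def dualD (d r : E → V) (q : ↥(dual1 d r)) : ↥(dual0 r) :=
  ⟨(d q.1.1, q.1.2), by
    obtain ⟨h1, h2⟩ := q.2
    exact ⟨h1, fun h0 => h2 h0⟩⟩

/-- The range map `r₁ : E₁¹ → E₁⁰`, `r₁(e',e) = (r(e'), e')`. -/
def dualR (d r : E → V) (q : ↥(dual1 d r)) : ↥(dual0 r) :=
  ⟨(r q.1.1, (q.1.1 : OnePoint E)), by
    refine ⟨fun e he => ?_, fun h0 => absurd h0 (OnePoint.coe_ne_infty _)⟩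
    obtain rfl : q.1.1 = e := OnePoint.coe_injective he
    rfl⟩

/-- The chain condition `(e_i, e_{i+1}) ∈ Ẽ₁¹` for a finite tuple. -/
def chainF (d r : E → V) {n : ℕ} (g : Fin n → OnePoint E) : Prop :=
  ∀ i : ℕ, ∀ h : i + 1 < n, (g ⟨i, by omega⟩, g ⟨i + 1, h⟩) ∈ tdual1 d r

/-- `E_{n+1}⁰`, the vertex space of the `(n+1)`-st iterated dual graph. -/
def iterV (d r : E → V) (n : ℕ) : Set (V × (Fin (n + 1) → OnePoint E)) :=
  {p | (p.1, p.2 ⟨0, by omega⟩) ∈ dual0 r ∧ chainF d r p.2}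

/-- `E_{n+1}¹`, the edge space of the `(n+1)`-st iterated dual graph. -/
def iterE (d r : E → V) (n : ℕ) : Set (E × (Fin (n + 1) → OnePoint E)) :=
  {p | (p.1, p.2 ⟨0, by omega⟩) ∈ dual1 d r ∧ chainF d r p.2}

/-- `Ẽ_{n+1}⁰ = E_{n+1}⁰ ∪ {(∞,…,∞)}`. -/
def titerV (d r : E → V) (n : ℕ) : Set (OnePoint V × (Fin (n + 1) → OnePoint E)) :=
  (fun p : V × (Fin (n + 1) → OnePoint E) => ((p.1 : OnePoint V), p.2)) '' iterV d r n ∪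
    {((∞ : OnePoint V), fun _ => ∞)}

/-- `Ẽ_{n+1}¹ = E_{n+1}¹ ∪ {(∞,…,∞)}`. -/
def titerE (d r : E → V) (n : ℕ) : Set (OnePoint E × (Fin (n + 1) → OnePoint E)) :=
  (fun p : E × (Fin (n + 1) → OnePoint E) => ((p.1 : OnePoint E), p.2)) '' iterE d r n ∪
    {((∞ : OnePoint E), fun _ => ∞)}

/-- The domain map `d_{n+1} : E_{n+1}¹ → E_{n+1}⁰`. -/
def iterD (d r : E → V) (n : ℕ) (q : ↥(iterE d r n)) : ↥(iterV d r n) :=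
  ⟨(d q.1.1, q.1.2), by
    obtain ⟨⟨h1, h2⟩, hc⟩ := q.2
    exact ⟨⟨h1, fun h0 => h2 h0⟩, hc⟩⟩

/-- The range map `r_{n+1} : E_{n+1}¹ → E_{n+1}⁰`. -/
def iterR (d r : E → V) (n : ℕ) (q : ↥(iterE d r n)) : ↥(iterV d r n) :=
  ⟨(r q.1.1, fun i : Fin (n + 1) =>
      Fin.cases ((q.1.1 : OnePoint E)) (fun j : Fin n => q.1.2 j.castSucc) i), by
    obtain ⟨⟨h1, h2⟩, hc⟩ := q.2
    constructor
    · refine ⟨fun e he => ?_, fun h0 => ?_⟩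
      · obtain rfl : q.1.1 = e := OnePoint.coe_injective he
        rfl
      · exact absurd h0 (OnePoint.coe_ne_infty _)
    · intro i hilt
      match i, hilt with
      | 0, hilt =>
        exact Or.inl ⟨(q.1.1, q.1.2 ⟨0, by omega⟩), ⟨h1, h2⟩, rfl⟩
      | (j + 1), hilt =>
        exact hc j (by omega)⟩

/-- Truncation `m⁰_{k,l} : E_{l+1}⁰ → E_{k+1}⁰` (for `k ≤ l`). -/
def iterTrunc (d r : E → V) {k l : ℕ} (h : k ≤ l) (x : ↥(iterV d r l)) : ↥(iterV d r k) :=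
  ⟨(x.1.1, fun i : Fin (k + 1) => x.1.2 ⟨(i : ℕ), by have := i.2; omega⟩), by
    obtain ⟨h0, hc⟩ := x.2
    exact ⟨h0, fun i hi => hc i (by omega)⟩⟩

/-- The chain condition `(e_i, e_{i+1}) ∈ Ẽ₁¹` for an infinite sequence. -/
def chainInf (d r : E → V) (g : ℕ → OnePoint E) : Prop :=
  ∀ i : ℕ, (g i, g (i + 1)) ∈ tdual1 d r

/-- `E∞⁰`, the vertex space of the projective-limit graph. -/
def infV (d r : E → V) : Set (V × (ℕ → OnePoint E)) :=
  {p | (p.1, p.2 0) ∈ dual0 r ∧ chainInf d r p.2}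

/-- `E∞¹`, the edge space of the projective-limit graph. -/
def infE (d r : E → V) : Set (E × (ℕ → OnePoint E)) :=
  {p | (p.1, p.2 0) ∈ dual1 d r ∧ chainInf d r p.2}

/-- `Ẽ∞⁰ = E∞⁰ ∪ {(∞,∞,…)}`. -/
def tinfV (d r : E → V) : Set (OnePoint V × (ℕ → OnePoint E)) :=
  (fun p : V × (ℕ → OnePoint E) => ((p.1 : OnePoint V), p.2)) '' infV d r ∪
    {((∞ : OnePoint V), fun _ => ∞)}

/-- `Ẽ∞¹ = E∞¹ ∪ {(∞,∞,…)}`. -/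
def tinfE (d r : E → V) : Set (OnePoint E × (ℕ → OnePoint E)) :=
  (fun p : E × (ℕ → OnePoint E) => ((p.1 : OnePoint E), p.2)) '' infE d r ∪
    {((∞ : OnePoint E), fun _ => ∞)}

/-- The domain map `d∞ : E∞¹ → E∞⁰`. -/
def infD (d r : E → V) (q : ↥(infE d r)) : ↥(infV d r) :=
  ⟨(d q.1.1, q.1.2), by
    obtain ⟨⟨h1, h2⟩, hc⟩ := q.2
    exact ⟨⟨h1, fun h0 => h2 h0⟩, hc⟩⟩

/-- The range map `r∞ : E∞¹ → E∞⁰`. -/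
def infR (d r : E → V) (q : ↥(infE d r)) : ↥(infV d r) :=
  ⟨(r q.1.1, fun i : ℕ => Nat.casesOn i ((q.1.1 : OnePoint E)) (fun j => q.1.2 j)), by
    obtain ⟨⟨h1, h2⟩, hc⟩ := q.2
    constructor
    · refine ⟨fun e he => ?_, fun h0 => ?_⟩
      · obtain rfl : q.1.1 = e := OnePoint.coe_injective he
        rfl
      · exact absurd h0 (OnePoint.coe_ne_infty _)
    · intro i
      match i with
      | 0 => exact Or.inl ⟨(q.1.1, q.1.2 0), ⟨h1, h2⟩, rfl⟩
      | (j + 1) => exact hc j⟩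

/-- Finite paths of length `n+1` ending at a singular vertex: `E^{n+1}_sg`. -/
def finPathSg (d r : E → V) (n : ℕ) : Set (Fin (n + 1) → E) :=
  {g | (∀ i : ℕ, ∀ h : i + 1 < n + 1, d (g ⟨i, by omega⟩) = r (g ⟨i + 1, h⟩)) ∧
    d (g ⟨n, by omega⟩) ∈ grSg r}

/-- Infinite paths `E^∞`. -/
def infPath (d r : E → V) : Set (ℕ → E) :=
  {g | ∀ i : ℕ, d (g i) = r (g (i + 1))}

/-- The vertex space `E_U⁰` of the relative dual graph. -/
def rdual0 (r : E → V) (U : Set V) : Set (V × OnePoint E) :=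
  {p | (∀ e : E, p.2 = (e : OnePoint E) → p.1 = r e) ∧ (p.2 = ∞ → p.1 ∉ U)}

/-- The edge space `E_U¹` of the relative dual graph. -/
def rdual1 (d r : E → V) (U : Set V) : Set (E × OnePoint E) :=
  {p | (∀ e : E, p.2 = (e : OnePoint E) → d p.1 = r e) ∧ (p.2 = ∞ → d p.1 ∉ U)}

/-- `Ẽ_U⁰ = E_U⁰ ∪ {(∞,∞)}`. -/
def trdual0 (r : E → V) (U : Set V) : Set (OnePoint V × OnePoint E) :=
  (fun p : V × OnePoint E => ((p.1 : OnePoint V), p.2)) '' rdual0 r U ∪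
    {((∞ : OnePoint V), (∞ : OnePoint E))}

/-- `Ẽ_U¹ = E_U¹ ∪ {(∞,∞)}`. -/
def trdual1 (d r : E → V) (U : Set V) : Set (OnePoint E × OnePoint E) :=
  (fun p : E × OnePoint E => ((p.1 : OnePoint E), p.2)) '' rdual1 d r U ∪
    {((∞ : OnePoint E), (∞ : OnePoint E))}

/-- The domain map `d_U : E_U¹ → E_U⁰`. -/
def rdualD (d r : E → V) (U : Set V) (q : ↥(rdual1 d r U)) : ↥(rdual0 r U) :=
  ⟨(d q.1.1, q.1.2), by
    obtain ⟨h1, h2⟩ := q.2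
    exact ⟨h1, h2⟩⟩

/-- The range map `r_U : E_U¹ → E_U⁰`. -/
def rdualR (d r : E → V) (U : Set V) (q : ↥(rdual1 d r U)) : ↥(rdual0 r U) :=
  ⟨(r q.1.1, (q.1.1 : OnePoint E)), by
    refine ⟨fun e he => ?_, fun h0 => absurd h0 (OnePoint.coe_ne_infty _)⟩
    obtain rfl : q.1.1 = e := OnePoint.coe_injective he
    rfl⟩

theorem isOpen_grFin {V : Type u} {E : Type w} [TopologicalSpace V] [TopologicalSpace E]
    (r : E → V) : IsOpen (grFin r) :=
  isOpen_iff_mem_nhds.2 fun _ ⟨U, hU, hv, hK⟩ =>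
    Filter.mem_of_superset (hU.mem_nhds hv) fun _ hu => ⟨U, hU, hu, hK⟩

theorem isOpen_grRg {V : Type u} {E : Type w} [TopologicalSpace V] [TopologicalSpace E]
    (r : E → V) : IsOpen (grRg r) :=
  (isOpen_grFin r).sdiff isClosed_closure

/-- Every regular vertex is the range of some edge. -/
theorem grRg_subset_range {V : Type u} {E : Type w} [TopologicalSpace V] [T2Space V]
    [TopologicalSpace E] {r : E → V} (hr : Continuous r) : grRg r ⊆ Set.range r := by
  rintro v ⟨⟨U, hU, hv, hK⟩, hsce⟩
  have hcl : v ∈ closure (Set.range r) := by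
    by_contra h
    exact hsce (subset_closure h)
  have himage : v ∈ closure (r '' (r ⁻¹' U)) := by
    rw [Set.image_preimage_eq_inter_range]
    exact hU.inter_closure ⟨hv, hcl⟩
  rw [(hK.image hr).isClosed.closure_eq] at himage
  exact Set.image_subset_range _ _ himage

theorem isClosed_dual0 {V : Type u} {E : Type w} [TopologicalSpace V] [T2Space V]
    [TopologicalSpace E] [T2Space E] {r : E → V} (hr : Continuous r) : IsClosed (dual0 r) := by
  rw [← isOpen_compl_iff, isOpen_iff_mem_nhds]
  rintro ⟨v, e⟩ hp
  induction e using OnePoint.rec with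
  | infty =>
    have hv : v ∈ grRg r := by
      by_contra h
      exact hp ⟨fun e he => absurd he (OnePoint.infty_ne_coe e), fun _ => h⟩
    obtain ⟨U, hU, hvU, hK⟩ := hv.1
    have hopen : IsOpen ((U ∩ grRg r) ×ˢ ((↑) '' (r ⁻¹' U) : Set (OnePoint E))ᶜ) :=
      (hU.inter (isOpen_grRg r)).prod (OnePoint.isOpen_compl_image_coe.2 ⟨hK.isClosed, hK⟩)
    refine Filter.mem_of_superset
      (hopen.mem_nhds ⟨⟨hvU, hv⟩, OnePoint.infty_notMem_image_coe⟩) ?_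
    rintro ⟨u, e⟩ ⟨⟨huU, hu⟩, he⟩ ⟨h1, h2⟩
    induction e using OnePoint.rec with
    | infty => exact h2 rfl hu
    | coe e =>
      have hue : u = r e := h1 e rfl
      subst hue
      exact he ⟨e, huU, rfl⟩
  | coe e =>
    have hv : v ≠ r e := fun h => hp
      ⟨fun e' he => OnePoint.coe_injective he ▸ h, fun he => absurd he (OnePoint.coe_ne_infty e)⟩
    have hopen : IsOpen (Prod.map id ((↑) : E → OnePoint E) '' {p : V × E | p.1 ≠ r p.2}) :=
      (IsOpenMap.id.prodMap OnePoint.isOpenEmbedding_coe.isOpenMap) _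
        (isOpen_ne_fun continuous_fst (hr.comp continuous_snd))
    refine Filter.mem_of_superset (hopen.mem_nhds ⟨(v, e), hv, rfl⟩) ?_
    rintro _ ⟨⟨u, e'⟩, hu, rfl⟩ ⟨h1, -⟩
    exact hu (h1 e' rfl)

theorem isClosed_dual1 {V : Type u} {E : Type w} [TopologicalSpace V] [T2Space V]
    [TopologicalSpace E] [T2Space E] {d r : E → V} (hd : Continuous d) (hr : Continuous r) :
    IsClosed (dual1 d r) :=
  (isClosed_dual0 hr).preimage (hd.prodMap continuous_id)

/-- The first projection of a closed subset of `X × Y` is proper when `Y` is compact. -/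
theorem IsClosed.isProperMap_fst {X Y : Type*} [TopologicalSpace X] [TopologicalSpace Y]
    [CompactSpace Y] {s : Set (X × Y)} (hs : IsClosed s) :
    IsProperMap fun q : s => (q : X × Y).1 :=
  isProperMap_fst_of_compactSpace.comp hs.isProperMap_subtypeVal

theorem surjective_dual0_fst {V : Type u} {E : Type w} [TopologicalSpace V] [T2Space V]
    [TopologicalSpace E] {r : E → V} (hr : Continuous r) :
    Function.Surjective fun q : ↥(dual0 r) => (q : V × OnePoint E).1 := by
  intro v
  by_cases hv : v ∈ grRg r
  · obtain ⟨e, rfl⟩ := grRg_subset_range hr hv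
    exact ⟨⟨(r e, e), fun e' he => congrArg r (OnePoint.coe_injective he),
      fun he => absurd he (OnePoint.coe_ne_infty e)⟩, rfl⟩
  · exact ⟨⟨(v, ∞), fun e he => absurd he (OnePoint.infty_ne_coe e), fun _ => hv⟩, rfl⟩

theorem surjective_dual1_fst {V : Type u} {E : Type w} [TopologicalSpace V] [T2Space V]
    [TopologicalSpace E] (d : E → V) {r : E → V} (hr : Continuous r) :
    Function.Surjective fun q : ↥(dual1 d r) => (q : E × OnePoint E).1 := by
  intro e'
  obtain ⟨⟨⟨v, e⟩, hw⟩, rfl : v = d e'⟩ := surjective_dual0_fst hr (d e')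
  exact ⟨⟨(e', e), hw⟩, rfl⟩

theorem existsUnique_dual1_lift {V : Type u} {E : Type w} [TopologicalSpace V]
    [TopologicalSpace E] (d r : E → V) (e' : E) (w : ↥(dual0 r))
    (h : d e' = (w : V × OnePoint E).1) :
    ∃! f : ↥(dual1 d r), (f : E × OnePoint E).1 = e' ∧ dualD d r f = w := by
  obtain ⟨⟨v, e⟩, hw⟩ := w
  obtain rfl : d e' = v := h
  refine ⟨⟨(e', e), hw⟩, ⟨rfl, rfl⟩, ?_⟩
  rintro ⟨⟨a, b⟩, hf⟩ ⟨rfl, hD⟩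
  exact Subtype.ext (Prod.ext rfl (congrArg (fun q : ↥(dual0 r) => (q : V × OnePoint E).2) hD))

/-- Vertices of the dual graph lying over regular vertices are ranges of dual edges. -/
theorem preimage_grRg_subset_range_dualR {V : Type u} {E : Type w} [TopologicalSpace V]
    [T2Space V] [TopologicalSpace E] (d : E → V) {r : E → V} (hr : Continuous r) :
    (fun q : ↥(dual0 r) => (q : V × OnePoint E).1) ⁻¹' grRg r ⊆ Set.range (dualR d r) := by
  rintro ⟨⟨v, e⟩, h1, h2⟩ (hv : v ∈ grRg r)
  induction e using OnePoint.rec with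
  | infty => exact absurd hv (h2 rfl)
  | coe e =>
    obtain ⟨f, rfl : f.1.1 = e⟩ := surjective_dual1_fst d hr e
    exact ⟨f, Subtype.ext (Prod.ext (h1 f.1.1 rfl).symm rfl)⟩

theorem preimage_grRg_subset_grRg_dualR {V : Type u} {E : Type w} [TopologicalSpace V]
    [T2Space V] [TopologicalSpace E] [T2Space E] {d r : E → V} (hd : Continuous d)
    (hr : Continuous r) :
    (fun q : ↥(dual0 r) => (q : V × OnePoint E).1) ⁻¹' grRg r ⊆ grRg (dualR d r) := by
  have hcont : Continuous fun q : ↥(dual0 r) => (q : V × OnePoint E).1 :=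
    continuous_fst.comp continuous_subtype_val
  intro q hq
  obtain ⟨U, hU, hqU, hK⟩ := hq.1
  refine ⟨⟨_, hU.preimage hcont, hqU,
    (isClosed_dual1 hd hr).isProperMap_fst.isCompact_preimage hK⟩, ?_⟩
  have hdisj : Disjoint ((fun q : ↥(dual0 r) => (q : V × OnePoint E).1) ⁻¹' grRg r)
      (grSce (dualR d r)) :=
    Set.disjoint_compl_right_iff_subset.2
      ((preimage_grRg_subset_range_dualR d hr).trans subset_closure)
  exact Set.disjoint_left.1 (hdisj.closure_right ((isOpen_grRg r).preimage hcont)) hq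

section Statements

variable {V : Type u} {E : Type w}

theorem statement6
    [TopologicalSpace V] [T2Space V] [LocallyCompactSpace V]
    [TopologicalSpace E] [T2Space E] [LocallyCompactSpace E]
    (d r : E → V) (hd : IsLocalHomeomorph d) (hr : Continuous r) :
    Continuous (fun q : ↥(dual0 r) => (q : V × OnePoint E).1) ∧
    IsProperMap (fun q : ↥(dual0 r) => (q : V × OnePoint E).1) ∧
    Function.Surjective (fun q : ↥(dual0 r) => (q : V × OnePoint E).1) ∧
    Continuous (fun q : ↥(dual1 d r) => (q : E × OnePoint E).1) ∧
    IsProperMap (fun q : ↥(dual1 d r) => (q : E × OnePoint E).1) ∧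
    Function.Surjective (fun q : ↥(dual1 d r) => (q : E × OnePoint E).1) ∧
    (∀ q : ↥(dual1 d r), d (q : E × OnePoint E).1 = (dualD d r q : V × OnePoint E).1) ∧
    (∀ q : ↥(dual1 d r), r (q : E × OnePoint E).1 = (dualR d r q : V × OnePoint E).1) ∧
    (∀ (e' : E) (w : ↥(dual0 r)), d e' = (w : V × OnePoint E).1 →
      ∃! f : ↥(dual1 d r), (f : E × OnePoint E).1 = e' ∧ dualD d r f = w) ∧
    (fun q : ↥(dual0 r) => (q : V × OnePoint E).1) ⁻¹' grRg r ⊆ grRg (dualR d r) := by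
  have hp0 := (isClosed_dual0 hr).isProperMap_fst
  have hp1 := (isClosed_dual1 hd.continuous hr).isProperMap_fst
  exact ⟨hp0.continuous, hp0, surjective_dual0_fst hr, hp1.continuous, hp1,
    surjective_dual1_fst d hr, fun _ => rfl, fun _ => rfl, existsUnique_dual1_lift d r,
    preimage_grRg_subset_grRg_dualR hd.continuous hr⟩

end Statements
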